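/- arXiv:2304.04908 — 2 statements merged into one kernel-verified Lean document; each statement's English description precedes it below -/
import Mathlib

section
/- Let 1 ≤ l ≤ n−1 and i ∈ ℤ. Then there is a unique 𝕜-algebra homomorphism φ_{l,i} : H_{mn}(ξ) → M_{2n}(𝕜) such that φ_{l,i}(a) = A(l,i), φ_{l,i}(b) = B(l,i), φ_{l,i}(c) = C(l,i) and φ_{l,i}(d) = D; equivalently, these four matrices satisfy all the defining relations of H_{mn}(ξ): A(l,i)^n = B(l,i)^n − I, B(l,i)^{mn} = C(l,i)^{mn} = I, D^n = 0, A(l,i)B(l,i) = q·B(l,i)A(l,i), D·C(l,i) = ξ·C(l,i)D, B(l,i)C(l,i) = C(l,i)B(l,i), B(l,i)D = q·D·B(l,i), A(l,i)D − D·A(l,i) = B(l,i) − C(l,i)^m, and A(l,i)C(l,i) = ξ^{−1}C(l,i)A(l,i) + ((ξ^{−1} − ξ^{n−1})/(n−1)!_q)(C(l,i)^{m+1} − q·B(l,i)C(l,i))D^{n−1}. -/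
noncomputable section

namespace Radford

variable (𝕜 : Type) [Field 𝕜]

/-- The q-integer `(k)_q = 1 + q + ⋯ + q^(k-1)`. -/
def qInt (q : 𝕜) (k : ℕ) : 𝕜 := ∑ j ∈ Finset.range k, q ^ j

/-- The q-factorial `(k)!_q = (1)_q (2)_q ⋯ (k)_q`. -/
def qFact (q : 𝕜) : ℕ → 𝕜
  | 0 => 1
  | k + 1 => qFact q k * qInt 𝕜 q (k + 1)

variable (m n : ℕ) (ξ : 𝕜)

/-- Generators of the free algebra: 0 ↦ a, 1 ↦ b, 2 ↦ c, 3 ↦ d. -/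
def fgen (k : Fin 4) : FreeAlgebra 𝕜 (Fin 4) := FreeAlgebra.ι 𝕜 k

local notation "fa" => fgen 𝕜 0
local notation "fb" => fgen 𝕜 1
local notation "fc" => fgen 𝕜 2
local notation "fd" => fgen 𝕜 3

/-- The defining relations of the Drinfeld double `H_{mn}(ξ) = D(R_{mn}(q))`, where `q = ξ^m`. -/
inductive HRel : FreeAlgebra 𝕜 (Fin 4) → FreeAlgebra 𝕜 (Fin 4) → Prop
  | aPow : HRel (fa ^ n) (fb ^ n - 1)
  | bPow : HRel (fb ^ (m * n)) 1
  | cPow : HRel (fc ^ (m * n)) 1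
  | dPow : HRel (fd ^ n) 0
  | ab : HRel (fa * fb) (ξ ^ m • (fb * fa))
  | dc : HRel (fd * fc) (ξ • (fc * fd))
  | bc : HRel (fb * fc) (fc * fb)
  | bd : HRel (fb * fd) (ξ ^ m • (fd * fb))
  | ad : HRel (fa * fd - fd * fa) (fb - fc ^ m)
  | ac : HRel (fa * fc)
      (ξ⁻¹ • (fc * fa) +
        ((ξ⁻¹ - ξ ^ (n - 1)) / qFact 𝕜 (ξ ^ m) (n - 1)) •
          ((fc ^ (m + 1) - ξ ^ m • (fb * fc)) * fd ^ (n - 1)))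

/-- The Drinfeld double `H_{mn}(ξ)` of the Radford Hopf algebra `R_{mn}(q)`, presented by
generators `a, b, c, d` and the above relations. -/
def H := RingQuot (HRel 𝕜 m n ξ)

instance : Ring (H 𝕜 m n ξ) := inferInstanceAs (Ring (RingQuot (HRel 𝕜 m n ξ)))

instance : Algebra 𝕜 (H 𝕜 m n ξ) := inferInstanceAs (Algebra 𝕜 (RingQuot (HRel 𝕜 m n ξ)))

/-- The generators `a, b, c, d` of `H_{mn}(ξ)` (indexed by 0,1,2,3). -/
def gen (k : Fin 4) : H 𝕜 m n ξ := RingQuot.mkAlgHom 𝕜 (HRel 𝕜 m n ξ) (fgen 𝕜 k)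

local notation "ha" => gen 𝕜 m n ξ 0
local notation "hb" => gen 𝕜 m n ξ 1
local notation "hc" => gen 𝕜 m n ξ 2
local notation "hd" => gen 𝕜 m n ξ 3

/-- The Jacobson radical `J` of `H_{mn}(ξ)`. -/
def jrad : Ideal (H 𝕜 m n ξ) := Ideal.jacobson ⊥

/-- The scalars `α_k(l,i)`;  `alph l i k` is `α_k(l,i)`, where `q = ξ^m`. -/
def alph (l : ℕ) (i : ℤ) (k : ℕ) : 𝕜 :=
  if k = n then ((ξ ^ m) ^ (i + (l : ℤ)) - (ξ ^ m) ^ i) / qFact 𝕜 (ξ ^ m) (n - 1)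
  else qInt 𝕜 (ξ ^ m) k * ((ξ ^ m) ^ i - (ξ ^ m) ^ (i + (l : ℤ) - (k : ℤ)))

/-- The scalars `γ_k(l,i)`;  `gam l i k` is `γ_k(l,i)`, where `q = ξ^m`. -/
def gam (l : ℕ) (i : ℤ) (k : ℕ) : 𝕜 :=
  if k = n then ((ξ ^ m) ^ i - (ξ ^ m) ^ (i + (l : ℤ))) / qFact 𝕜 (ξ ^ m) (n - 1)
  else qInt 𝕜 (ξ ^ m) k * ((ξ ^ m) ^ (i + (l : ℤ)) - (ξ ^ m) ^ (i - (k : ℤ)))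

section ModuleH

variable {W : Type} [AddCommGroup W] [Module (H 𝕜 m n ξ) W]

variable (W) in
/-- The socle of an `H`-module: the sum of all simple submodules. -/
def socle : Submodule (H 𝕜 m n ξ) W :=
  sSup {N : Submodule (H 𝕜 m n ξ) W | IsSimpleModule (H 𝕜 m n ξ) N}

variable (W) in
/-- The submodule `J•W`, the radical of `W`. -/
def radM : Submodule (H 𝕜 m n ξ) W :=
  Submodule.span (H 𝕜 m n ξ) {x | ∃ r ∈ jrad 𝕜 m n ξ, ∃ w : W, x = r • w}

variable (W) in
/-- The submodule `J²•W`. -/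
def rad2M : Submodule (H 𝕜 m n ξ) W :=
  Submodule.span (H 𝕜 m n ξ)
    {x | ∃ r ∈ jrad 𝕜 m n ξ, ∃ s ∈ jrad 𝕜 m n ξ, ∃ w : W, x = r • s • w}

variable (W) in
/-- The submodule `J³•W`. -/
def rad3M : Submodule (H 𝕜 m n ξ) W :=
  Submodule.span (H 𝕜 m n ξ)
    {x | ∃ r ∈ jrad 𝕜 m n ξ, ∃ s ∈ jrad 𝕜 m n ξ, ∃ t ∈ jrad 𝕜 m n ξ, ∃ w : W, x = r • s • t • w}

variable (W) in
/-- `lengthIs c W` : the `H`-module `W` has a composition series of length `c`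
(hence, by Jordan–Hölder, has composition length `c`). -/
def lengthIs (c : ℕ) : Prop :=
  ∃ s : CompositionSeries (Submodule (H 𝕜 m n ξ) W), s.head = ⊥ ∧ s.last = ⊤ ∧ s.length = c

variable (W) in
/-- An `H`-module is indecomposable if it is nonzero and is not the direct sum of two
nonzero submodules. -/
def Indec : Prop :=
  Nontrivial W ∧ ∀ N₁ N₂ : Submodule (H 𝕜 m n ξ) W, IsCompl N₁ N₂ → N₁ = ⊥ ∨ N₂ = ⊥

variable (W) in
/-- `W` has Loewy length 2: `J•W ≠ 0` and `J²•W = 0`. -/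
def LoewyLen2 : Prop := radM 𝕜 m n ξ W ≠ ⊥ ∧ rad2M 𝕜 m n ξ W = ⊥

variable (W) in
/-- `W` is of `(s,t)`-type: it has Loewy length `2`, its socle has composition length `t`,
and `W/soc W` has composition length `s`. -/
def IsType (s t : ℕ) : Prop :=
  LoewyLen2 𝕜 m n ξ W ∧ lengthIs 𝕜 m n ξ (socle 𝕜 m n ξ W) t ∧
    lengthIs 𝕜 m n ξ (W ⧸ socle 𝕜 m n ξ W) s

end ModuleH

section ModuleK

variable {V : Type} [AddCommGroup V] [Module 𝕜 V] [Module (H 𝕜 m n ξ) V]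
  [IsScalarTower 𝕜 (H 𝕜 m n ξ) V]

variable (V) in
/-- `V^d = {v ∈ V | d•v = 0}`, as a `𝕜`-subspace. -/
def dKer : Submodule 𝕜 V where
  carrier := {v | hd • v = 0}
  add_mem' := by
    intro x y hx hy
    simp only [Set.mem_setOf_eq] at *
    rw [smul_add, hx, hy, add_zero]
  zero_mem' := smul_zero _
  smul_mem' := by
    intro r v hv
    simp only [Set.mem_setOf_eq] at *
    rw [smul_comm, hv, smul_zero]

variable (V) in
/-- `V_{(i)} = {v ∈ V | c•v = ξ^i v}`, as a `𝕜`-subspace. -/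
def eigsp (i : ℤ) : Submodule 𝕜 V where
  carrier := {v | hc • v = ξ ^ i • v}
  add_mem' := by
    intro x y hx hy
    simp only [Set.mem_setOf_eq] at *
    rw [smul_add, hx, hy, smul_add]
  zero_mem' := by simp
  smul_mem' := by
    intro r v hv
    simp only [Set.mem_setOf_eq] at *
    rw [smul_comm, hv, smul_comm]

/-- `V`, equipped with the family `mv : Fin l → V`, realizes the simple module `M(l,i)`:
`mv` is a basis of `V` and the generators act by the defining formulas of `M(l,i)`. -/
def IsMrep (l : ℕ) (i : ℤ) (mv : Fin l → V) : Prop :=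
  LinearIndependent 𝕜 mv ∧ Submodule.span 𝕜 (Set.range mv) = ⊤ ∧
  (∀ (j : ℕ) (hj : j + 1 < l),
    ha • mv ⟨j, by omega⟩ = alph 𝕜 m n ξ l i (j + 1) • mv ⟨j + 1, hj⟩) ∧
  (∀ (j : ℕ) (hj : j < l), j + 1 = l → ha • mv ⟨j, hj⟩ = 0) ∧
  (∀ j : Fin l, hb • mv j = ((ξ ^ m) ^ (i + (l : ℤ) - ((j : ℕ) + 1 : ℤ)) : 𝕜) • mv j) ∧
  (∀ j : Fin l, hc • mv j = (ξ ^ (i + (j : ℕ) : ℤ) : 𝕜) • mv j) ∧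
  (∀ (j : ℕ) (hj : j + 1 < l), hd • mv ⟨j + 1, hj⟩ = mv ⟨j, by omega⟩) ∧
  (∀ hl : 0 < l, hd • mv ⟨0, hl⟩ = 0)

/-- `V` realizes the induced module `Z(λ_{ij})`: there is a cyclic vector `z` with
`d•z = 0`, `b•z = ξ^j z`, `c•z = ξ^i z` such that `(a^k • z)_{0 ≤ k ≤ n-1}` is a basis. -/
def IsZrep (i j : ℤ) (V : Type) [AddCommGroup V] [Module 𝕜 V] [Module (H 𝕜 m n ξ) V]
    [IsScalarTower 𝕜 (H 𝕜 m n ξ) V] : Prop :=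
  ∃ z : V, hd • z = 0 ∧ hb • z = (ξ ^ j : 𝕜) • z ∧ hc • z = (ξ ^ i : 𝕜) • z ∧
    LinearIndependent 𝕜 (fun k : Fin n => (ha ^ (k : ℕ)) • z) ∧
    Submodule.span 𝕜 (Set.range fun k : Fin n => (ha ^ (k : ℕ)) • z) = ⊤

/-- `V`, equipped with the families `v u : Fin n → V`, realizes the projective module `P(l,i)`
with its standard basis. -/
def IsPrep (l : ℕ) (hl1 : 1 ≤ l) (hl2 : l < n) (i : ℤ) (v u : Fin n → V) : Prop :=
  LinearIndependent 𝕜 (Sum.elim v u) ∧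
  Submodule.span 𝕜 (Set.range v ∪ Set.range u) = ⊤ ∧
  (∀ (j : ℕ) (hj : j + l + 2 ≤ n),
    ha • v ⟨j, by omega⟩ = gam 𝕜 m n ξ l i (j + 1) • v ⟨j + 1, by omega⟩) ∧
  (∀ (j : ℕ) (hj : j + 1 < n), n ≤ j + 1 + l →
    ha • v ⟨j, by omega⟩ =
      gam 𝕜 m n ξ l i (j + 1) • v ⟨j + 1, hj⟩ + u ⟨j + 1 + l - n, by omega⟩) ∧
  (ha • v ⟨n - 1, by omega⟩ = gam 𝕜 m n ξ l i n • v ⟨0, by omega⟩ + u ⟨l, by omega⟩) ∧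
  (∀ (j : ℕ) (hj : j + 1 < n),
    ha • u ⟨j, by omega⟩ = alph 𝕜 m n ξ l i (j + 1) • u ⟨j + 1, hj⟩) ∧
  (ha • u ⟨n - 1, by omega⟩ = alph 𝕜 m n ξ l i n • u ⟨0, by omega⟩) ∧
  (∀ j : Fin n, hb • v j = ((ξ ^ m) ^ (i + (n : ℤ) - ((j : ℕ) + 1 : ℤ)) : 𝕜) • v j) ∧
  (∀ j : Fin n, hb • u j = ((ξ ^ m) ^ (i + (l : ℤ) - ((j : ℕ) + 1 : ℤ)) : 𝕜) • u j) ∧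
  (∀ j : Fin n, hc • v j = (ξ ^ (i - ((n : ℤ) - (l : ℤ)) + (j : ℕ) : ℤ) : 𝕜) • v j) ∧
  (∀ j : Fin n, hc • u j = (ξ ^ (i + (j : ℕ) : ℤ) : 𝕜) • u j) ∧
  (hd • v ⟨0, by omega⟩ = 0) ∧
  (∀ (j : ℕ) (hj : j + 1 < n), hd • v ⟨j + 1, hj⟩ = v ⟨j, by omega⟩) ∧
  (hd • u ⟨0, by omega⟩ = 0) ∧
  (∀ (j : ℕ) (hj : j + 1 < n), hd • u ⟨j + 1, hj⟩ = u ⟨j, by omega⟩)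

/-- `V`, equipped with the basis `e : Fin n → V`, realizes the module `T_1(l,i)`. -/
def IsT1rep (l : ℕ) (hl1 : 1 ≤ l) (hl2 : l < n) (i : ℤ) (e : Fin n → V) : Prop :=
  LinearIndependent 𝕜 e ∧ Submodule.span 𝕜 (Set.range e) = ⊤ ∧
  (∀ (j : ℕ) (hj : j + 1 < n),
    ha • e ⟨j, by omega⟩ = alph 𝕜 m n ξ l i (j + 1) • e ⟨j + 1, hj⟩) ∧
  (ha • e ⟨n - 1, by omega⟩ = alph 𝕜 m n ξ l i n • e ⟨0, by omega⟩) ∧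
  (∀ j : Fin n, hb • e j = ((ξ ^ m) ^ (i + (l : ℤ) - ((j : ℕ) + 1 : ℤ)) : 𝕜) • e j) ∧
  (∀ j : Fin n, hc • e j = (ξ ^ (i + (j : ℕ) : ℤ) : 𝕜) • e j) ∧
  (hd • e ⟨0, by omega⟩ = 0) ∧
  (∀ (j : ℕ) (hj : j + 1 < n), hd • e ⟨j + 1, hj⟩ = e ⟨j, by omega⟩)

/-- `V`, equipped with the basis `e : Fin n → V`, realizes the module `T̄_1(l,i)`. -/
def IsT1barrep (l : ℕ) (hl1 : 1 ≤ l) (hl2 : l < n) (i : ℤ) (e : Fin n → V) : Prop :=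
  LinearIndependent 𝕜 e ∧ Submodule.span 𝕜 (Set.range e) = ⊤ ∧
  (∀ (j : ℕ) (hj : j + 1 < n - l),
    ha • e ⟨j, by omega⟩ = alph 𝕜 m n ξ (n - l) (i + l - n) (j + 1) • e ⟨j + 1, by omega⟩) ∧
  (ha • e ⟨n - l - 1, by omega⟩ = e ⟨n - l, by omega⟩) ∧
  (∀ (k : ℕ) (hk : k + 1 < l),
    ha • e ⟨n - l + k, by omega⟩ = alph 𝕜 m n ξ l i (k + 1) • e ⟨n - l + k + 1, by omega⟩) ∧
  (ha • e ⟨n - 1, by omega⟩ = 0) ∧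
  (∀ j : Fin n, hb • e j = ((ξ ^ m) ^ (i - ((j : ℕ) + 1 : ℤ)) : 𝕜) • e j) ∧
  (∀ j : Fin n, hc • e j = (ξ ^ (i + (l : ℤ) - (n : ℤ) + (j : ℕ) : ℤ) : 𝕜) • e j) ∧
  (hd • e ⟨0, by omega⟩ = 0) ∧
  (∀ (j : ℕ) (hj : j + 1 < n - l), hd • e ⟨j + 1, by omega⟩ = e ⟨j, by omega⟩) ∧
  (hd • e ⟨n - l, by omega⟩ = 0) ∧
  (∀ (k : ℕ) (hk : k + 1 < l), hd • e ⟨n - l + k + 1, by omega⟩ = e ⟨n - l + k, by omega⟩)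

end ModuleK

section Matrices

/-- The nilpotent Jordan-type matrix `D_s` with `1` on the superdiagonal. -/
def Dmat (s : ℕ) : Matrix (Fin s) (Fin s) 𝕜 :=
  fun r c => if (r : ℕ) + 1 = (c : ℕ) then 1 else 0

/-- The matrix `X_{l,i}` : subdiagonal entries `γ_k(l,i)`, `(1,n)`-entry `γ_n(l,i)`. -/
def Xmat (l : ℕ) (i : ℤ) : Matrix (Fin n) (Fin n) 𝕜 := fun r c =>
  if (r : ℕ) = (c : ℕ) + 1 then gam 𝕜 m n ξ l i ((c : ℕ) + 1)
  else if (r : ℕ) = 0 ∧ (c : ℕ) = n - 1 then gam 𝕜 m n ξ l i n else 0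

/-- The matrix `Z_{l,i}` : subdiagonal entries `α_k(l,i)`, `(1,n)`-entry `α_n(l,i)`. -/
def Zmat (l : ℕ) (i : ℤ) : Matrix (Fin n) (Fin n) 𝕜 := fun r c =>
  if (r : ℕ) = (c : ℕ) + 1 then alph 𝕜 m n ξ l i ((c : ℕ) + 1)
  else if (r : ℕ) = 0 ∧ (c : ℕ) = n - 1 then alph 𝕜 m n ξ l i n else 0

/-- The block matrix `A(l,i) = [[X_{l,i}, 0], [D_n^{n-l-1}, Z_{l,i}]]`. -/
def Amat (l : ℕ) (i : ℤ) : Matrix (Fin n ⊕ Fin n) (Fin n ⊕ Fin n) 𝕜 :=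
  Matrix.fromBlocks (Xmat 𝕜 m n ξ l i) 0 (Dmat 𝕜 n ^ (n - l - 1)) (Zmat 𝕜 m n ξ l i)

/-- The diagonal matrix `B(l,i)`. -/
def Bmat (l : ℕ) (i : ℤ) : Matrix (Fin n ⊕ Fin n) (Fin n ⊕ Fin n) 𝕜 :=
  Matrix.fromBlocks
    (Matrix.diagonal fun j : Fin n => (ξ ^ m) ^ (i - ((j : ℕ) + 1 : ℤ))) 0 0
    (Matrix.diagonal fun j : Fin n => (ξ ^ m) ^ (i + (l : ℤ) - ((j : ℕ) + 1 : ℤ)))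

/-- The diagonal matrix `C(l,i)`. -/
def Cmat (l : ℕ) (i : ℤ) : Matrix (Fin n ⊕ Fin n) (Fin n ⊕ Fin n) 𝕜 :=
  Matrix.fromBlocks
    (Matrix.diagonal fun j : Fin n => ξ ^ (i + (l : ℤ) - (n : ℤ) + (j : ℕ))) 0 0
    (Matrix.diagonal fun j : Fin n => ξ ^ (i + (j : ℕ) : ℤ))

/-- The block matrix `D = diag(D_n, D_n)`. -/
def Dbig : Matrix (Fin n ⊕ Fin n) (Fin n ⊕ Fin n) 𝕜 :=
  Matrix.fromBlocks (Dmat 𝕜 n) 0 0 (Dmat 𝕜 n)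

end Matrices

/-- An endomorphism acting on two families `v`, `u` along weighted cycles of length `n`, with `v`
leaking into `u`, is nilpotent of order `n` provided each cycle is broken by a zero weight and the
two paths from `v (n - 1)` to `u 0` cancel. -/
theorem end_pow_apply_eq_zero {R E : Type*} [CommRing R] [AddCommGroup E] [Module R E]
    (f : Module.End R E) (v u : ℕ → E) (γ α : ℕ → R) {n l : ℕ} (hl : 1 ≤ l) (hln : l < n)
    (hv_low : ∀ j, j + l + 1 < n → f (v j) = γ (j + 1) • v (j + 1))
    (hv_high : ∀ j, j + 1 < n → n ≤ j + l + 1 →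
      f (v j) = γ (j + 1) • v (j + 1) + u (j + l + 1 - n))
    (hv_last : f (v (n - 1)) = γ n • v 0 + u l)
    (hu : ∀ j, j + 1 < n → f (u j) = α (j + 1) • u (j + 1))
    (hu_last : f (u (n - 1)) = α n • u 0)
    (hγ : γ (n - l) = 0) (hα : α l = 0) (hαγ : α n = -γ n)
    (hshift : ∀ k, k + l + 1 < n → α (k + l + 1) = γ (k + 1)) {j : ℕ} (hj : j < n) :
    (f ^ n) (v j) = 0 ∧ (f ^ n) (u j) = 0 := by
  have step : ∀ s x, (f ^ (s + 1)) x = (f ^ s) (f x) := fun s x => by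
    rw [pow_succ, Module.End.mul_apply]
  have u_low : ∀ s j, j < l → l ≤ j + s → (f ^ s) (u j) = 0 := by
    intro s
    induction s with
    | zero => intro j h1 h2; omega
    | succ s ih =>
      intro j h1 h2
      rw [step, hu j (by omega), map_smul]
      rcases (show j + 1 ≤ l from h1).eq_or_lt with h | h
      · rw [h, hα, zero_smul]
      · rw [ih (j + 1) h (by omega), smul_zero]
  have u_high : ∀ s j, l ≤ j → j < n → n + l ≤ j + s → (f ^ s) (u j) = 0 := by
    intro s
    induction s with
    | zero => intro j h1 h2 h3; omega
    | succ s ih =>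
      intro j h1 h2 h3
      rw [step]
      rcases (show j + 1 ≤ n from h2).eq_or_lt with h | h
      · obtain rfl : j = n - 1 := by omega
        rw [hu_last, map_smul, u_low s 0 (by omega) (by omega), smul_zero]
      · rw [hu j h, map_smul, ih (j + 1) (by omega) h (by omega), smul_zero]
  have v_low : ∀ s j, j + l < n → n ≤ j + s → (f ^ s) (v j) = 0 := by
    intro s
    induction s with
    | zero => intro j h1 h2; omega
    | succ s ih =>
      intro j h1 h2
      rw [step]
      rcases (show j + l + 1 ≤ n from h1).eq_or_lt with h | h
      · rw [hv_high j (by omega) h.ge, show j + 1 = n - l by omega, hγ, zero_smul, zero_add,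
          h, Nat.sub_self]
        exact u_low s 0 (by omega) (by omega)
      · rw [hv_low j h, map_smul, ih (j + 1) (by omega) (by omega), smul_zero]
  have v_path : ∀ k, k + l < n →
      (f ^ k) (v 0) = (∏ x ∈ Finset.range k, γ (x + 1)) • v k := by
    intro k
    induction k with
    | zero => simp
    | succ k ih =>
      intro hk
      rw [pow_succ', Module.End.mul_apply, ih (by omega), map_smul, hv_low k (by omega),
        Finset.prod_range_succ, mul_smul]
  have u_path : ∀ k, k + l < n →
      (f ^ k) (u l) = (∏ x ∈ Finset.range k, γ (x + 1)) • u (k + l) := by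
    intro k
    induction k with
    | zero => simp
    | succ k ih =>
      intro hk
      rw [pow_succ', Module.End.mul_apply, ih (by omega), map_smul, hu (k + l) (by omega),
        hshift k (by omega), Finset.prod_range_succ, mul_smul, show k + 1 + l = k + l + 1 by omega]
  have cancel : ∀ s, n ≤ s + l → (f ^ s) (γ n • v 0 + u l) = 0 := by
    intro s hs
    obtain ⟨t, rfl⟩ : ∃ t, s = t + (n - l - 1 + 1) := ⟨s - (n - l), by omega⟩
    have hv0 := hv_high (n - l - 1) (by omega) (by omega)
    rw [show n - l - 1 + 1 = n - l by omega, hγ, zero_smul, zero_add,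
      show n - l - 1 + l + 1 - n = 0 by omega] at hv0
    rw [pow_add, Module.End.mul_apply, pow_succ' f (n - l - 1), Module.End.mul_apply, map_add,
      map_smul, v_path _ (by omega), u_path _ (by omega), map_add, map_smul, map_smul, map_smul,
      hv0, show n - l - 1 + l = n - 1 by omega, hu_last, hαγ, smul_comm, ← smul_add, ← add_smul,
      add_neg_cancel, zero_smul, smul_zero, map_zero]
  have v_high : ∀ s j, n ≤ j + l → j < n → n + n ≤ j + l + s → (f ^ s) (v j) = 0 := by
    intro s
    induction s with
    | zero => intro j h1 h2 h3; omega
    | succ s ih =>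
      intro j h1 h2 h3
      rw [step]
      rcases (show j + 1 ≤ n from h2).eq_or_lt with h | h
      · obtain rfl : j = n - 1 := by omega
        rw [hv_last]
        exact cancel s (by omega)
      · rw [hv_high j h (by omega), map_add, map_smul, ih (j + 1) (by omega) h (by omega),
          u_low s _ (by omega) (by omega), smul_zero, add_zero]
  constructor
  · rcases lt_or_ge (j + l) n with h | h
    · exact v_low n j h (by omega)
    · exact v_high n j h hj (by omega)
  · rcases lt_or_ge j l with h | h
    · exact u_low n j h (by omega)
    · exact u_high n j h hj (by omega)

variable {𝕜 m n ξ}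

theorem Dmat_mul_apply {s : ℕ} (M : Matrix (Fin s) (Fin s) 𝕜) (r c : Fin s) :
    (Dmat 𝕜 s * M) r c = if h : (r : ℕ) + 1 < s then M ⟨r + 1, h⟩ c else 0 := by
  rw [Matrix.mul_apply]
  split_ifs with h
  · rw [Finset.sum_eq_single ⟨r + 1, h⟩]
    · simp [Dmat]
    · intro x _ hx
      have : (r : ℕ) + 1 ≠ x := fun e => hx (Fin.ext e.symm)
      simp [Dmat, this]
    · simp
  · refine Finset.sum_eq_zero fun x _ => ?_
    have : (r : ℕ) + 1 ≠ x := by omega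
    simp [Dmat, this]

theorem mul_Dmat_apply {s : ℕ} (M : Matrix (Fin s) (Fin s) 𝕜) (r c : Fin s) :
    (M * Dmat 𝕜 s) r c = if 0 < (c : ℕ) then M r ⟨c - 1, by omega⟩ else 0 := by
  rw [Matrix.mul_apply]
  split_ifs with h
  · rw [Finset.sum_eq_single ⟨c - 1, by omega⟩]
    · simp [Dmat, Nat.sub_add_cancel h]
    · intro x _ hx
      have : (x : ℕ) + 1 ≠ c := fun e => hx (Fin.ext (by simp; omega))
      simp [Dmat, this]
    · simp
  · refine Finset.sum_eq_zero fun x _ => ?_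
    have : (x : ℕ) + 1 ≠ c := by omega
    simp [Dmat, this]

theorem Dmat_pow_apply {s : ℕ} (k : ℕ) (r c : Fin s) :
    (Dmat 𝕜 s ^ k) r c = if (r : ℕ) + k = c then 1 else 0 := by
  induction k generalizing r with
  | zero => simp [Matrix.one_apply, Fin.ext_iff]
  | succ k ih =>
    rw [pow_succ', Dmat_mul_apply]
    split_ifs <;> first | (rw [ih]; simp; omega) | omega | rfl

theorem Dbig_pow (k : ℕ) :
    Dbig 𝕜 n ^ k = Matrix.fromBlocks (Dmat 𝕜 n ^ k) 0 0 (Dmat 𝕜 n ^ k) :=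
  Matrix.fromBlocks_diagonal_pow _ _ _

theorem Dbig_pow_self : Dbig 𝕜 n ^ n = 0 := by
  have h : Dmat 𝕜 n ^ n = 0 := by
    ext r c
    rw [Dmat_pow_apply, if_neg (by omega), Matrix.zero_apply]
  rw [Dbig_pow, h, Matrix.fromBlocks_zero]

theorem Bmat_eq_diagonal (l : ℕ) (i : ℤ) : Bmat 𝕜 m n ξ l i = Matrix.diagonal
    (Sum.elim (fun j : Fin n => (ξ ^ m) ^ (i - ((j : ℕ) + 1 : ℤ)))
      fun j : Fin n => (ξ ^ m) ^ (i + (l : ℤ) - ((j : ℕ) + 1 : ℤ))) :=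
  Matrix.fromBlocks_diagonal _ _

theorem Cmat_eq_diagonal (l : ℕ) (i : ℤ) : Cmat 𝕜 n ξ l i = Matrix.diagonal
    (Sum.elim (fun j : Fin n => ξ ^ (i + (l : ℤ) - (n : ℤ) + (j : ℕ)))
      fun j : Fin n => ξ ^ (i + (j : ℕ) : ℤ)) :=
  Matrix.fromBlocks_diagonal _ _

theorem zpow_pow_eq_one {x : 𝕜} {k : ℕ} (h : x ^ k = 1) (z : ℤ) : (x ^ z) ^ k = 1 := by
  rw [← zpow_natCast, zpow_comm, zpow_natCast, h, one_zpow]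

theorem Bmat_pow_eq_one (h : ξ ^ (m * n) = 1) (l : ℕ) (i : ℤ) : Bmat 𝕜 m n ξ l i ^ n = 1 := by
  rw [Bmat_eq_diagonal, Matrix.diagonal_pow, ← Matrix.diagonal_one]
  congr 1
  ext (j | j) <;> exact zpow_pow_eq_one (by rw [← pow_mul, h]) _

theorem Cmat_pow_eq_one (h : ξ ^ (m * n) = 1) (l : ℕ) (i : ℤ) :
    Cmat 𝕜 n ξ l i ^ (m * n) = 1 := by
  rw [Cmat_eq_diagonal, Matrix.diagonal_pow, ← Matrix.diagonal_one]
  congr 1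
  ext (j | j) <;> exact zpow_pow_eq_one h _

theorem Bmat_mul_Cmat_comm (l : ℕ) (i : ℤ) :
    Bmat 𝕜 m n ξ l i * Cmat 𝕜 n ξ l i = Cmat 𝕜 n ξ l i * Bmat 𝕜 m n ξ l i := by
  rw [Bmat_eq_diagonal, Cmat_eq_diagonal]
  exact (Matrix.commute_diagonal _ _).eq

theorem Dbig_mul_Cmat (hξ : ξ ≠ 0) (l : ℕ) (i : ℤ) :
    Dbig 𝕜 n * Cmat 𝕜 n ξ l i = ξ • (Cmat 𝕜 n ξ l i * Dbig 𝕜 n) := by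
  rw [Cmat_eq_diagonal]
  ext (r | r) (c | c) <;>
    simp only [Matrix.mul_diagonal, Matrix.diagonal_mul, Matrix.smul_apply, Dbig, Sum.elim_inl,
      Sum.elim_inr, Matrix.fromBlocks_apply₁₁, Matrix.fromBlocks_apply₁₂,
      Matrix.fromBlocks_apply₂₁, Matrix.fromBlocks_apply₂₂, Dmat, Matrix.zero_apply, smul_eq_mul,
      mul_zero, zero_mul]
  all_goals
    split_ifs with h
    · rw [one_mul, mul_one, ← zpow_one_add₀ hξ, ← h]
      congr 1
      push_cast
      ring
    · simp

theorem Bmat_mul_Dbig (hξ : ξ ≠ 0) (l : ℕ) (i : ℤ) :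
    Bmat 𝕜 m n ξ l i * Dbig 𝕜 n = ξ ^ m • (Dbig 𝕜 n * Bmat 𝕜 m n ξ l i) := by
  rw [Bmat_eq_diagonal]
  ext (r | r) (c | c) <;>
    simp only [Matrix.mul_diagonal, Matrix.diagonal_mul, Matrix.smul_apply, Dbig, Sum.elim_inl,
      Sum.elim_inr, Matrix.fromBlocks_apply₁₁, Matrix.fromBlocks_apply₁₂,
      Matrix.fromBlocks_apply₂₁, Matrix.fromBlocks_apply₂₂, Dmat, Matrix.zero_apply, smul_eq_mul,
      mul_zero, zero_mul]
  all_goals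
    split_ifs with h
    · rw [one_mul, mul_one, ← zpow_one_add₀ (pow_ne_zero m hξ), ← h]
      congr 1
      push_cast
      ring
    · simp

theorem zpow_sub_natCast_of_pow_eq_one {x : 𝕜} (hx : x ≠ 0) {k : ℕ} (h : x ^ k = 1) (z : ℤ) :
    x ^ (z - k) = x ^ z := by
  rw [zpow_sub₀ hx, zpow_natCast, h, div_one]

theorem Amat_mul_Bmat (hξ : ξ ≠ 0) (h : ξ ^ (m * n) = 1) {l : ℕ} (hl : l < n) (i : ℤ) :
    Amat 𝕜 m n ξ l i * Bmat 𝕜 m n ξ l i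
      = ξ ^ m • (Bmat 𝕜 m n ξ l i * Amat 𝕜 m n ξ l i) := by
  have hq : ξ ^ m ≠ 0 := pow_ne_zero m hξ
  have hqn : (ξ ^ m) ^ n = 1 := by rw [← pow_mul, h]
  rw [Bmat_eq_diagonal]
  ext (r | r) (c | c) <;>
    simp only [Matrix.mul_diagonal, Matrix.diagonal_mul, Matrix.smul_apply, Amat, Sum.elim_inl,
      Sum.elim_inr, Matrix.fromBlocks_apply₁₁, Matrix.fromBlocks_apply₁₂,
      Matrix.fromBlocks_apply₂₁, Matrix.fromBlocks_apply₂₂, Xmat, Zmat, Dmat_pow_apply,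
      Matrix.zero_apply, smul_eq_mul, mul_zero, zero_mul, ← mul_assoc, ← zpow_one_add₀ hq]
  · split_ifs with h1 h2
    · rw [mul_comm, h1]
      congr 2
      push_cast
      ring
    · rw [mul_comm, ← zpow_sub_natCast_of_pow_eq_one hq hqn (1 + _)]
      congr 2
      omega
    · simp
  · split_ifs with h1
    · rw [one_mul, mul_one, ← zpow_sub_natCast_of_pow_eq_one hq hqn (1 + _)]
      congr 1
      omega
    · simp
  · split_ifs with h1 h2
    · rw [mul_comm, h1]
      congr 2
      push_cast
      ring
    · rw [mul_comm, ← zpow_sub_natCast_of_pow_eq_one hq hqn (1 + _)]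
      congr 2
      omega
    · simp

theorem sub_one_mul_qInt (q : 𝕜) (k : ℕ) : (q - 1) * qInt 𝕜 q k = q ^ k - 1 :=
  mul_geom_sum q k

theorem alph_add_eq_gam (hξ : ξ ≠ 0) (hq1 : ξ ^ m ≠ 1) {l k : ℕ} (hk : k + l < n)
    (i : ℤ) : alph 𝕜 m n ξ l i (k + l) = gam 𝕜 m n ξ l i k := by
  have hq : ξ ^ m ≠ 0 := pow_ne_zero m hξ
  rw [alph, gam, if_neg hk.ne, if_neg (by omega)]
  refine mul_left_cancel₀ (sub_ne_zero.mpr hq1) ?_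
  rw [← mul_assoc, ← mul_assoc, sub_one_mul_qInt, sub_one_mul_qInt]
  push_cast
  rw [show i + (l : ℤ) - (k + l) = i - k by ring, zpow_sub₀ hq, zpow_add₀ hq, pow_add]
  simp only [zpow_natCast]
  field_simp

theorem qInt_mul_sub_succ {q : 𝕜} (hq : q ≠ 0) (a b : ℤ) (k : ℕ) :
    qInt 𝕜 q k * (q ^ a - q ^ (b - k)) - qInt 𝕜 q (k + 1) * (q ^ a - q ^ (b - (k + 1 : ℕ)))
      = q ^ (b - (k + 1 : ℕ)) - q ^ (a + k) := by
  have h1 : qInt 𝕜 q (k + 1) = q * qInt 𝕜 q k + 1 := geom_sum_succ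
  have h2 : qInt 𝕜 q (k + 1) = q ^ k + qInt 𝕜 q k := geom_sum_succ'
  have h3 : q ^ (b - k) = q * q ^ (b - (k + 1 : ℕ)) := by
    rw [← zpow_one_add₀ hq]
    congr 1
    push_cast
    ring
  rw [h3, zpow_add₀ hq, zpow_natCast]
  linear_combination q ^ (b - (k + 1 : ℕ)) * h1 - q ^ a * h2

theorem qInt_eq_zero {q : 𝕜} (hq1 : q ≠ 1) (h : q ^ n = 1) : qInt 𝕜 q n = 0 := by
  refine mul_left_cancel₀ (sub_ne_zero.mpr hq1) ?_
  rw [sub_one_mul_qInt, h, sub_self, mul_zero]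

/-- The weighted cyclic shift `e_k ↦ w_k e_{k+1}` (1-based indices modulo `n`). -/
def cyclicShift (n : ℕ) (w : ℕ → 𝕜) : Matrix (Fin n) (Fin n) 𝕜 := fun r c =>
  if (r : ℕ) = (c : ℕ) + 1 then w ((c : ℕ) + 1)
  else if (r : ℕ) = 0 ∧ (c : ℕ) = n - 1 then w n else 0

theorem Xmat_eq_cyclicShift (l : ℕ) (i : ℤ) :
    Xmat 𝕜 m n ξ l i = cyclicShift n (gam 𝕜 m n ξ l i) := rfl

theorem Zmat_eq_cyclicShift (l : ℕ) (i : ℤ) :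
    Zmat 𝕜 m n ξ l i = cyclicShift n (alph 𝕜 m n ξ l i) := rfl

theorem cyclicShift_mul_Dmat_sub {q : 𝕜} (hq : q ≠ 0) (hq1 : q ≠ 1) (hqn : q ^ n = 1) (a b : ℤ)
    {w : ℕ → 𝕜} (hw : ∀ k < n, w k = qInt 𝕜 q k * (q ^ a - q ^ (b - k))) :
    cyclicShift n w * Dmat 𝕜 n - Dmat 𝕜 n * cyclicShift n w
      = Matrix.diagonal (fun j : Fin n => q ^ (b - (j + 1 : ℕ)) - q ^ (a + (j : ℕ))) := by
  ext r c
  rw [Matrix.sub_apply, mul_Dmat_apply, Dmat_mul_apply, Matrix.diagonal_apply]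
  have hrn := r.2
  have hcn := c.2
  split_ifs with h1 h2 h3 h3 h2 h3 h3 <;> try simp only [cyclicShift]
  · subst h3
    rw [if_pos (by omega), if_pos rfl, Nat.sub_add_cancel h1, hw _ hrn, hw _ h2,
      qInt_mul_sub_succ hq]
  · have := Fin.val_ne_of_ne h3
    rw [if_neg (by omega), if_neg (by omega), if_neg (by omega), if_neg (by omega), sub_zero]
  · subst h3
    rw [if_pos (by omega), Nat.sub_add_cancel h1, hw _ hrn, ← qInt_mul_sub_succ hq a b,
      show (r : ℕ) + 1 = n by omega, qInt_eq_zero hq1 hqn, zero_mul]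
  · have := Fin.val_ne_of_ne h3
    rw [if_neg (by omega), if_neg (by omega), sub_zero]
  · subst h3
    rw [if_pos rfl, hw _ h2, ← qInt_mul_sub_succ hq a b, show (r : ℕ) = 0 by omega]
    simp [qInt]
  · have := Fin.val_ne_of_ne h3
    rw [if_neg (by omega), if_neg (by omega), sub_zero]
  · subst h3
    exact absurd (show q = 1 by rwa [show n = 1 by omega, pow_one] at hqn) hq1
  · rw [sub_zero]

theorem gam_of_lt (l : ℕ) (i : ℤ) {k : ℕ} (hk : k < n) : gam 𝕜 m n ξ l i k
    = qInt 𝕜 (ξ ^ m) k * ((ξ ^ m) ^ (i + (l : ℤ)) - (ξ ^ m) ^ (i - (k : ℤ))) :=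
  if_neg hk.ne

theorem alph_of_lt (l : ℕ) (i : ℤ) {k : ℕ} (hk : k < n) : alph 𝕜 m n ξ l i k
    = qInt 𝕜 (ξ ^ m) k * ((ξ ^ m) ^ i - (ξ ^ m) ^ (i + (l : ℤ) - (k : ℤ))) :=
  if_neg hk.ne

theorem gam_self (l : ℕ) (i : ℤ) : gam 𝕜 m n ξ l i n
    = ((ξ ^ m) ^ i - (ξ ^ m) ^ (i + (l : ℤ))) / qFact 𝕜 (ξ ^ m) (n - 1) :=
  if_pos rfl

theorem alph_self (l : ℕ) (i : ℤ) : alph 𝕜 m n ξ l i n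
    = ((ξ ^ m) ^ (i + (l : ℤ)) - (ξ ^ m) ^ i) / qFact 𝕜 (ξ ^ m) (n - 1) :=
  if_pos rfl

theorem Amat_mul_Dbig_sub (hξ : ξ ≠ 0) (h : ξ ^ (m * n) = 1) (hq1 : ξ ^ m ≠ 1) (l : ℕ) (i : ℤ) :
    Amat 𝕜 m n ξ l i * Dbig 𝕜 n - Dbig 𝕜 n * Amat 𝕜 m n ξ l i
      = Bmat 𝕜 m n ξ l i - Cmat 𝕜 n ξ l i ^ m := by
  have hq : ξ ^ m ≠ 0 := pow_ne_zero m hξ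
  have hqn : (ξ ^ m) ^ n = 1 := by rw [← pow_mul, h]
  have hX := cyclicShift_mul_Dmat_sub hq hq1 hqn _ _ fun k => gam_of_lt (m := m) (ξ := ξ) l i
  have hZ := cyclicShift_mul_Dmat_sub hq hq1 hqn _ _ fun k => alph_of_lt (m := m) (ξ := ξ) l i
  have hpow (z : ℤ) : (ξ ^ z) ^ m = (ξ ^ m) ^ z := by
    rw [← zpow_natCast, zpow_comm, zpow_natCast]
  rw [Bmat_eq_diagonal, Cmat_eq_diagonal, Matrix.diagonal_pow, Matrix.diagonal_sub, Amat, Dbig,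
    Matrix.fromBlocks_multiply, Matrix.fromBlocks_multiply, sub_eq_add_neg (Matrix.fromBlocks _ _ _ _),
    Matrix.fromBlocks_neg, Matrix.fromBlocks_add]
  simp only [← sub_eq_add_neg, Matrix.zero_mul, Matrix.mul_zero, add_zero, zero_add,
    Xmat_eq_cyclicShift, Zmat_eq_cyclicShift, hX, hZ, pow_mul_comm', sub_self]
  rw [Matrix.fromBlocks_diagonal]
  congr 1
  ext (j | j) <;> simp only [Sum.elim_inl, Sum.elim_inr, Pi.pow_apply, hpow]
  · rw [show i + (l : ℤ) - n + (j : ℕ) = i + l + (j : ℕ) - n by ring,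
      zpow_sub_natCast_of_pow_eq_one hq hqn]
    push_cast
    rfl
  · push_cast
    rfl

theorem Amat_mul_Cmat (hξ : ξ ≠ 0) (h : ξ ^ (m * n) = 1) {l : ℕ} (hl : l < n) (i : ℤ) :
    Amat 𝕜 m n ξ l i * Cmat 𝕜 n ξ l i
      = ξ⁻¹ • (Cmat 𝕜 n ξ l i * Amat 𝕜 m n ξ l i) +
        ((ξ⁻¹ - ξ ^ (n - 1)) / qFact 𝕜 (ξ ^ m) (n - 1)) •
          ((Cmat 𝕜 n ξ l i ^ (m + 1) - ξ ^ m • (Bmat 𝕜 m n ξ l i * Cmat 𝕜 n ξ l i)) *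
            Dbig 𝕜 n ^ (n - 1)) := by
  have hq : ξ ^ m ≠ 0 := pow_ne_zero m hξ
  have hqn : (ξ ^ m) ^ n = 1 := by rw [← pow_mul, h]
  have hpow (z : ℤ) : (ξ ^ z) ^ m = (ξ ^ m) ^ z := by
    rw [← zpow_natCast, zpow_comm, zpow_natCast]
  have hinv (z : ℤ) : ξ⁻¹ * ξ ^ z = ξ ^ (z - 1) := by
    rw [zpow_sub_one₀ hξ, mul_comm]
  rw [Bmat_eq_diagonal, Cmat_eq_diagonal, Matrix.diagonal_pow, Matrix.diagonal_mul_diagonal,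
    ← Matrix.diagonal_smul, Matrix.diagonal_sub, Dbig_pow]
  ext (r | r) (c | c) <;>
    simp only [Matrix.mul_diagonal, Matrix.diagonal_mul, Matrix.smul_apply, Amat, Sum.elim_inl,
      Sum.elim_inr, Matrix.fromBlocks_apply₁₁, Matrix.fromBlocks_apply₁₂,
      Matrix.fromBlocks_apply₂₁, Matrix.fromBlocks_apply₂₂, Xmat, Zmat, Dmat_pow_apply,
      Matrix.zero_apply, Matrix.add_apply, smul_eq_mul, mul_zero, zero_mul, add_zero,
      Pi.pow_apply, Pi.smul_apply]
  · by_cases h1 : (r : ℕ) = c + 1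
    · rw [if_pos h1, if_neg (by omega), mul_zero, mul_zero, add_zero, ← mul_assoc, hinv, mul_comm,
        h1]
      congr 2
      push_cast
      ring
    by_cases h2 : (r : ℕ) = 0 ∧ (c : ℕ) = n - 1
    · rw [if_neg h1, if_pos h2, if_pos (by omega), h2.1, h2.2, gam_self, pow_succ, hpow,
        Nat.cast_zero, add_zero, ← mul_assoc (ξ ^ m), ← zpow_one_add₀ hq,
        zpow_sub_natCast_of_pow_eq_one hq hqn, zpow_add₀ hξ _ ((n - 1 : ℕ) : ℤ),
        zpow_natCast, zero_add, show 1 + (i - 1) = i by ring]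
      ring
    · rw [if_neg h1, if_neg h2, if_neg (by omega)]
      simp
  · split_ifs with h1
    · rw [one_mul, mul_one, hinv]
      congr 1
      omega
    · simp
  · by_cases h1 : (r : ℕ) = c + 1
    · rw [if_pos h1, if_neg (by omega), mul_zero, mul_zero, add_zero, ← mul_assoc, hinv, mul_comm,
        h1]
      congr 2
      push_cast
      ring
    by_cases h2 : (r : ℕ) = 0 ∧ (c : ℕ) = n - 1
    · rw [if_neg h1, if_pos h2, if_pos (by omega), h2.1, h2.2, alph_self, pow_succ, hpow,
        Nat.cast_zero, add_zero, ← mul_assoc (ξ ^ m), ← zpow_one_add₀ hq,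
        zpow_add₀ hξ _ ((n - 1 : ℕ) : ℤ),
        zpow_natCast, zero_add, show 1 + (i + (l : ℤ) - 1) = i + l by ring]
      ring
    · rw [if_neg h1, if_neg h2, if_neg (by omega)]
      simp

theorem Amat_pow_eq_zero (hξ : ξ ≠ 0) (h : ξ ^ (m * n) = 1) (hq1 : ξ ^ m ≠ 1) {l : ℕ}
    (hl1 : 1 ≤ l) (hl : l < n) (i : ℤ) : Amat 𝕜 m n ξ l i ^ n = 0 := by
  have hq : ξ ^ m ≠ 0 := pow_ne_zero m hξ
  have hqn : (ξ ^ m) ^ n = 1 := by rw [← pow_mul, h]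
  let v : ℕ → Fin n ⊕ Fin n → 𝕜 := fun j => Sum.elim (fun r => if (r : ℕ) = j then 1 else 0) 0
  let u : ℕ → Fin n ⊕ Fin n → 𝕜 := fun j => Sum.elim 0 (fun r => if (r : ℕ) = j then 1 else 0)
  have v_eq (j : ℕ) (hj : j < n) : v j = Pi.single (Sum.inl ⟨j, hj⟩) 1 := by
    ext (r | r) <;> simp [v, Pi.single_apply, Fin.ext_iff]
  have u_eq (j : ℕ) (hj : j < n) : u j = Pi.single (Sum.inr ⟨j, hj⟩) 1 := by
    ext (r | r) <;> simp [u, Pi.single_apply, Fin.ext_iff]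
  have toLin'_v (M : Matrix (Fin n ⊕ Fin n) (Fin n ⊕ Fin n) 𝕜) (j : ℕ) (hj : j < n) :
      M.toLin' (v j) = M.col (Sum.inl ⟨j, hj⟩) := by
    rw [v_eq j hj, Matrix.toLin'_apply, Matrix.mulVec_single_one]
  have toLin'_u (M : Matrix (Fin n ⊕ Fin n) (Fin n ⊕ Fin n) 𝕜) (j : ℕ) (hj : j < n) :
      M.toLin' (u j) = M.col (Sum.inr ⟨j, hj⟩) := by
    rw [u_eq j hj, Matrix.toLin'_apply, Matrix.mulVec_single_one]
  have key := fun j => end_pow_apply_eq_zero (Amat 𝕜 m n ξ l i).toLin' v u (gam 𝕜 m n ξ l i)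
    (alph 𝕜 m n ξ l i) hl1 hl (j := j) ?_ ?_ ?_ ?_ ?_ ?_ ?_ ?_ ?_
  · rw [← Matrix.toLin'_pow] at key
    ext r (c | c)
    · have := congrFun (key c c.2).1 r
      rwa [toLin'_v _ c c.2] at this
    · have := congrFun (key c c.2).2 r
      rwa [toLin'_u _ c c.2] at this
  · intro j hj
    rw [toLin'_v _ j (by omega)]
    ext (r | r) <;> simp [v, Amat, Xmat, Dmat_pow_apply] <;> grind
  · intro j hj1 hj2
    rw [toLin'_v _ j (by omega)]
    ext (r | r) <;> simp [v, u, Amat, Xmat, Dmat_pow_apply] <;> grind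
  · rw [toLin'_v _ (n - 1) (by omega)]
    ext (r | r) <;> simp [v, u, Amat, Xmat, Dmat_pow_apply] <;> grind
  · intro j hj
    rw [toLin'_u _ j (by omega)]
    ext (r | r) <;> simp [u, Amat, Zmat]
    grind
  · rw [toLin'_u _ (n - 1) (by omega)]
    ext (r | r) <;> simp [u, Amat, Zmat]
    grind
  · rw [gam_of_lt l i (by omega), Nat.cast_sub hl.le, sub_sub_eq_add_sub, 
      zpow_sub_natCast_of_pow_eq_one hq hqn, sub_self, mul_zero]
  · rw [alph_of_lt l i hl, add_sub_cancel_right, sub_self, mul_zero]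
  · rw [alph_self, gam_self, ← neg_div, neg_sub]
  · intro k hk
    rw [show k + l + 1 = k + 1 + l by ring]
    exact alph_add_eq_gam hξ hq1 (by omega) i

/-- Elements of any algebra satisfying the defining relations of `H_{mn}(ξ)` are the
images of the generators under a unique algebra homomorphism. -/
theorem existsUnique_algHom {S : Type*} [Ring S] [Algebra 𝕜 S] (g : Fin 4 → S)
    (hg : ∀ ⦃x y⦄, HRel 𝕜 m n ξ x y → FreeAlgebra.lift 𝕜 g x = FreeAlgebra.lift 𝕜 g y) :
    ∃! φ : H 𝕜 m n ξ →ₐ[𝕜] S, ∀ k, φ (gen 𝕜 m n ξ k) = g k := by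
  refine ⟨RingQuot.liftAlgHom 𝕜 ⟨FreeAlgebra.lift 𝕜 g, hg⟩, fun k => ?_, fun ψ hψ => ?_⟩
  · exact (RingQuot.liftAlgHom_mkAlgHom_apply 𝕜 _ hg _).trans (FreeAlgebra.lift_ι_apply g k)
  · refine RingQuot.liftAlgHom_unique 𝕜 _ hg ψ (FreeAlgebra.hom_ext (funext fun k => ?_))
    exact (hψ k).trans (FreeAlgebra.lift_ι_apply g k).symm

variable (𝕜 m n ξ)

/-- Lemma 3.7: there is a unique algebra map `φ_{l,i} : H_{mn}(ξ) → M_{2n}(𝕜)`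
sending `a, b, c, d` to `A(l,i), B(l,i), C(l,i), D`; equivalently these matrices satisfy all
the defining relations of `H_{mn}(ξ)`. -/
theorem statement2 (𝕜 : Type) [Field 𝕜] [IsAlgClosed 𝕜] (m n : ℕ) (hm : 1 < m) (hn : 1 < n)
    (ξ : 𝕜) (hξ : IsPrimitiveRoot ξ (m * n))
    (l : ℕ) (hl1 : 1 ≤ l) (hl2 : l ≤ n - 1) (i : ℤ) :
    (∃! φ : H 𝕜 m n ξ →ₐ[𝕜] Matrix (Fin n ⊕ Fin n) (Fin n ⊕ Fin n) 𝕜,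
      φ (gen 𝕜 m n ξ 0) = Amat 𝕜 m n ξ l i ∧
      φ (gen 𝕜 m n ξ 1) = Bmat 𝕜 m n ξ l i ∧
      φ (gen 𝕜 m n ξ 2) = Cmat 𝕜 n ξ l i ∧
      φ (gen 𝕜 m n ξ 3) = Dbig 𝕜 n) ∧
    Amat 𝕜 m n ξ l i ^ n = Bmat 𝕜 m n ξ l i ^ n - 1 ∧
    Bmat 𝕜 m n ξ l i ^ (m * n) = 1 ∧
    Cmat 𝕜 n ξ l i ^ (m * n) = 1 ∧
    Dbig 𝕜 n ^ n = 0 ∧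
    Amat 𝕜 m n ξ l i * Bmat 𝕜 m n ξ l i = ξ ^ m • (Bmat 𝕜 m n ξ l i * Amat 𝕜 m n ξ l i) ∧
    Dbig 𝕜 n * Cmat 𝕜 n ξ l i = ξ • (Cmat 𝕜 n ξ l i * Dbig 𝕜 n) ∧
    Bmat 𝕜 m n ξ l i * Cmat 𝕜 n ξ l i = Cmat 𝕜 n ξ l i * Bmat 𝕜 m n ξ l i ∧
    Bmat 𝕜 m n ξ l i * Dbig 𝕜 n = ξ ^ m • (Dbig 𝕜 n * Bmat 𝕜 m n ξ l i) ∧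
    Amat 𝕜 m n ξ l i * Dbig 𝕜 n - Dbig 𝕜 n * Amat 𝕜 m n ξ l i
      = Bmat 𝕜 m n ξ l i - Cmat 𝕜 n ξ l i ^ m ∧
    Amat 𝕜 m n ξ l i * Cmat 𝕜 n ξ l i
      = ξ⁻¹ • (Cmat 𝕜 n ξ l i * Amat 𝕜 m n ξ l i) +
        ((ξ⁻¹ - ξ ^ (n - 1)) / qFact 𝕜 (ξ ^ m) (n - 1)) •
          ((Cmat 𝕜 n ξ l i ^ (m + 1) - ξ ^ m • (Bmat 𝕜 m n ξ l i * Cmat 𝕜 n ξ l i)) *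
            Dbig 𝕜 n ^ (n - 1)) := by
  have hmn : m * n ≠ 0 := by positivity
  have hξ0 : ξ ≠ 0 := hξ.ne_zero hmn
  have h1 : ξ ^ (m * n) = 1 := hξ.pow_eq_one
  have hq1 : ξ ^ m ≠ 1 := hξ.pow_ne_one_of_pos_of_lt (by omega) (by nlinarith)
  have hln : l < n := by omega
  have rel_aPow : Amat 𝕜 m n ξ l i ^ n = Bmat 𝕜 m n ξ l i ^ n - 1 := by
    rw [Amat_pow_eq_zero hξ0 h1 hq1 hl1 hln, Bmat_pow_eq_one h1, sub_self]
  have rel_bPow : Bmat 𝕜 m n ξ l i ^ (m * n) = 1 := by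
    rw [mul_comm m n, pow_mul, Bmat_pow_eq_one h1, one_pow]
  have rel_cPow := Cmat_pow_eq_one h1 l i
  have rel_dPow := Dbig_pow_self (𝕜 := 𝕜) (n := n)
  have rel_ab := Amat_mul_Bmat hξ0 h1 hln i
  have rel_dc := Dbig_mul_Cmat (n := n) hξ0 l i
  have rel_bc := Bmat_mul_Cmat_comm (m := m) (n := n) (ξ := ξ) l i
  have rel_bd := Bmat_mul_Dbig (m := m) (n := n) hξ0 l i
  have rel_ad := Amat_mul_Dbig_sub hξ0 h1 hq1 l i
  have rel_ac := Amat_mul_Cmat hξ0 h1 hln i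
  refine ⟨?_, rel_aPow, rel_bPow, rel_cPow, rel_dPow, rel_ab, rel_dc, rel_bc, rel_bd, rel_ad,
    rel_ac⟩
  have key := existsUnique_algHom (m := m) (n := n) (ξ := ξ)
    ![Amat 𝕜 m n ξ l i, Bmat 𝕜 m n ξ l i, Cmat 𝕜 n ξ l i, Dbig 𝕜 n] fun x y hxy => by
      cases hxy <;>
        simpa only [fgen, map_pow, map_mul, map_sub, map_add, map_smul, map_one, map_zero,
          FreeAlgebra.lift_ι_apply]
  simp only [Fin.forall_fin_succ, IsEmpty.forall_iff, and_true] at key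
  exact key

end Radford
end
end

section
/- Let (i,j), (i′,j′) ∈ I_0. Then: (1) the induced module Z(λ_{ij}) is a simple H_{mn}(ξ)-module; (2) Z(λ_{ij}) ≅ Z(λ_{i′j′}) if and only if (i,j) = (i′,j′) in ℤ_{mn} × ℤ_{mn}. -/
noncomputable section

namespace Radford

variable (𝕜 : Type) [Field 𝕜]

variable (m n : ℕ) (ξ : 𝕜)

local notation "fa" => fgen 𝕜 0
local notation "fb" => fgen 𝕜 1
local notation "fc" => fgen 𝕜 2
local notation "fd" => fgen 𝕜 3

local notation "ha" => gen 𝕜 m n ξ 0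
local notation "hb" => gen 𝕜 m n ξ 1
local notation "hc" => gen 𝕜 m n ξ 2
local notation "hd" => gen 𝕜 m n ξ 3

section InducedModule

variable {𝕜 m n ξ}

/-- `z` is a highest weight vector: `d` kills it, and `b`, `c` act on it by `β`, `γ`. -/
structure IsHighestWeight {V : Type} [AddCommGroup V] [Module 𝕜 V] [Module (H 𝕜 m n ξ) V]
    (β γ : 𝕜) (z : V) : Prop where
  d_smul : hd • z = 0
  b_smul : hb • z = β • z
  c_smul : hc • z = γ • z

variable (𝕜 m n ξ) in
/-- The quotient map from the free algebra onto `H`. -/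
def mkH : FreeAlgebra 𝕜 (Fin 4) →ₐ[𝕜] H 𝕜 m n ξ := RingQuot.mkAlgHom 𝕜 (HRel 𝕜 m n ξ)

theorem mkH_fgen (k : Fin 4) : mkH 𝕜 m n ξ (fgen 𝕜 k) = gen 𝕜 m n ξ k := rfl

theorem mkH_eq_of_hRel {x y : FreeAlgebra 𝕜 (Fin 4)} (h : HRel 𝕜 m n ξ x y) :
    mkH 𝕜 m n ξ x = mkH 𝕜 m n ξ y :=
  RingQuot.mkAlgHom_rel 𝕜 h

theorem gen_a_pow : ha ^ n = hb ^ n - 1 := by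
  simpa [mkH_fgen] using mkH_eq_of_hRel (HRel.aPow (𝕜 := 𝕜) (m := m) (n := n) (ξ := ξ))

theorem gen_d_pow : hd ^ n = 0 := by
  simpa [mkH_fgen] using mkH_eq_of_hRel (HRel.dPow (𝕜 := 𝕜) (m := m) (n := n) (ξ := ξ))

theorem gen_a_mul_b : ha * hb = ξ ^ m • (hb * ha) := by
  simpa [mkH_fgen] using mkH_eq_of_hRel (HRel.ab (𝕜 := 𝕜) (m := m) (n := n) (ξ := ξ))

theorem gen_a_mul_d : ha * hd - hd * ha = hb - hc ^ m := by
  simpa [mkH_fgen] using mkH_eq_of_hRel (HRel.ad (𝕜 := 𝕜) (m := m) (n := n) (ξ := ξ))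

theorem gen_a_mul_c : ha * hc = ξ⁻¹ • (hc * ha) +
    ((ξ⁻¹ - ξ ^ (n - 1)) / qFact 𝕜 (ξ ^ m) (n - 1)) •
      ((hc ^ (m + 1) - ξ ^ m • (hb * hc)) * hd ^ (n - 1)) := by
  simpa [mkH_fgen] using mkH_eq_of_hRel (HRel.ac (𝕜 := 𝕜) (m := m) (n := n) (ξ := ξ))

/-- A 𝕜-linear map commuting with the generators is `H`-linear. -/
theorem map_smul_of_map_gen_smul {V W : Type} [AddCommGroup V] [Module 𝕜 V]
    [Module (H 𝕜 m n ξ) V] [IsScalarTower 𝕜 (H 𝕜 m n ξ) V] [AddCommGroup W] [Module 𝕜 W]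
    [Module (H 𝕜 m n ξ) W] [IsScalarTower 𝕜 (H 𝕜 m n ξ) W] (f : V →ₗ[𝕜] W)
    (hf : ∀ k v, f (gen 𝕜 m n ξ k • v) = gen 𝕜 m n ξ k • f v) (x : H 𝕜 m n ξ) (v : V) :
    f (x • v) = x • f v := by
  obtain ⟨x, rfl⟩ : ∃ y, mkH 𝕜 m n ξ y = x :=
    RingQuot.mkAlgHom_surjective 𝕜 (HRel 𝕜 m n ξ) x
  induction x using FreeAlgebra.induction generalizing v with
  | grade0 r => simp [algebraMap_smul]
  | grade1 k => exact hf k v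
  | mul x y hx hy => rw [map_mul, mul_smul, mul_smul, hx, hy]
  | add x y hx hy => rw [map_add, add_smul, add_smul, map_add, hx, hy]

theorem pow_smul_of_smul_eq {V : Type} [AddCommGroup V] [Module 𝕜 V] [Module (H 𝕜 m n ξ) V]
    [IsScalarTower 𝕜 (H 𝕜 m n ξ) V] {x : H 𝕜 m n ξ} {r : 𝕜} {v : V} (h : x • v = r • v) (k : ℕ) :
    x ^ k • v = r ^ k • v := by
  induction k with
  | zero => simp
  | succ k ih => rw [pow_succ', mul_smul, ih, smul_comm, h, smul_smul, pow_succ]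

/-- The scalar by which `d` sends `a ^ k • z` to `a ^ (k - 1) • z`. -/
def lowerCoeff (m : ℕ) (ξ β γ : 𝕜) (k : ℕ) : 𝕜 :=
  ∑ t ∈ Finset.range k, ((ξ ^ t * γ) ^ m - (ξ ^ m)⁻¹ ^ t * β)

theorem lowerCoeff_zero (β γ : 𝕜) : lowerCoeff m ξ β γ 0 = 0 := by
  simp [lowerCoeff]

theorem lowerCoeff_succ (β γ : 𝕜) (k : ℕ) : lowerCoeff m ξ β γ (k + 1) =
    lowerCoeff m ξ β γ k + ((ξ ^ k * γ) ^ m - (ξ ^ m)⁻¹ ^ k * β) :=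
  Finset.sum_range_succ _ _

theorem lowerCoeff_succ_ne_zero {β γ : 𝕜} (hm : 1 < m) (hn : 1 < n)
    (hξ : IsPrimitiveRoot ξ (m * n)) {k : ℕ} (hk : k + 1 < n) (h : (ξ ^ m) ^ k * γ ^ m ≠ β) :
    lowerCoeff m ξ β γ (k + 1) ≠ 0 := by
  have hq : IsPrimitiveRoot (ξ ^ m) n := hξ.pow (by positivity) rfl
  have hq0 : ξ ^ m ≠ 0 := hq.ne_zero (by omega)
  have key : ∀ k, (ξ ^ m - 1) * lowerCoeff m ξ β γ (k + 1) * (ξ ^ m) ^ k =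
      ((ξ ^ m) ^ (k + 1) - 1) * ((ξ ^ m) ^ k * γ ^ m - β) := by
    intro k
    induction k with
    | zero => simp [lowerCoeff]
    | succ k ih =>
      rw [lowerCoeff_succ]
      have e : (ξ ^ (k + 1)) ^ m = (ξ ^ m) ^ (k + 1) := pow_right_comm _ _ _
      rw [mul_pow, e]
      generalize ξ ^ m = q at *
      have hi : q⁻¹ ^ (k + 1) * q ^ (k + 1) = 1 := by
        rw [← mul_pow, inv_mul_cancel₀ hq0, one_pow]
      linear_combination q * ih - (q - 1) * β * hi
  intro h0
  have := key k
  rw [h0, mul_zero, zero_mul, eq_comm, mul_eq_zero, sub_eq_zero, sub_eq_zero] at this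
  exact this.elim (hq.pow_ne_one_of_pos_of_lt (by omega) hk) h

namespace IsHighestWeight

variable {V : Type} [AddCommGroup V] [Module 𝕜 V] [Module (H 𝕜 m n ξ) V]
  [IsScalarTower 𝕜 (H 𝕜 m n ξ) V] {β γ : 𝕜} {z : V}

theorem b_smul_pow (hz : IsHighestWeight (m := m) (n := n) (ξ := ξ) β γ z) (hξ : ξ ≠ 0) (k : ℕ) :
    hb • ha ^ k • z = ((ξ ^ m)⁻¹ ^ k * β) • ha ^ k • z := by
  have hba : hb * ha = (ξ ^ m)⁻¹ • (ha * hb) := by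
    rw [gen_a_mul_b, smul_smul, inv_mul_cancel₀ (pow_ne_zero _ hξ), one_smul]
  induction k with
  | zero => simpa using hz.b_smul
  | succ k ih =>
    rw [pow_succ' ha, mul_smul, ← mul_smul hb, hba, smul_assoc, mul_smul, ih, smul_comm ha,
      smul_smul, pow_succ', mul_assoc]

theorem d_pow_smul {k : ℕ}
    (h : ∀ l ≤ k, hd • ha ^ l • z = lowerCoeff m ξ β γ l • ha ^ (l - 1) • z) (s : ℕ) :
    hd ^ s • ha ^ k • z =
      (∏ t ∈ Finset.range s, lowerCoeff m ξ β γ (k - t)) • ha ^ (k - s) • z := by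
  induction s with
  | zero => simp
  | succ s ih =>
    rw [pow_succ', mul_smul, ih, smul_comm, h _ (by omega), smul_smul, Finset.prod_range_succ,
      Nat.sub_sub]

theorem c_d_smul_pow (hz : IsHighestWeight (m := m) (n := n) (ξ := ξ) β γ z) (hξ : ξ ≠ 0) (k : ℕ)
    (hk : k < n) : ∀ l ≤ k, hc • ha ^ l • z = (ξ ^ l * γ) • ha ^ l • z ∧
      hd • ha ^ l • z = lowerCoeff m ξ β γ l • ha ^ (l - 1) • z := by
  induction k with
  | zero =>
    intro l hl
    obtain rfl : l = 0 := by omega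
    simp [hz.c_smul, hz.d_smul, lowerCoeff_zero]
  | succ k ih =>
    have ih := ih (by omega)
    intro l hl
    obtain hl | rfl := Nat.le_succ_iff.mp hl
    · exact ih l hl
    constructor
    · have h0 : hd ^ (n - 1) • ha ^ k • z = 0 := by
        rw [d_pow_smul (fun l hl => (ih l hl).2),
          Finset.prod_eq_zero (Finset.mem_range.mpr (show k < n - 1 by omega)), zero_smul]
        rw [Nat.sub_self, lowerCoeff_zero]
      have h := congrArg (· • ha ^ k • z) (gen_a_mul_c (𝕜 := 𝕜) (m := m) (n := n) (ξ := ξ))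
      simp only [add_smul, smul_assoc, mul_smul, h0, smul_zero, add_zero] at h
      rw [(ih k le_rfl).1, smul_comm ha] at h
      rw [Nat.succ_eq_add_one, pow_succ' ha, mul_smul, pow_succ', mul_assoc, mul_smul ξ, h,
        smul_smul ξ, mul_inv_cancel₀ hξ, one_smul]
    · have h := congrArg (· • ha ^ k • z) (gen_a_mul_d (𝕜 := 𝕜) (m := m) (n := n) (ξ := ξ))
      simp only [sub_smul, mul_smul] at h
      rw [hz.b_smul_pow hξ, pow_smul_of_smul_eq (ih k le_rfl).1, (ih k le_rfl).2] at h
      rw [Nat.succ_eq_add_one, pow_succ' ha, mul_smul, ← sub_sub_self (ha • _) (hd • _), h]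
      rw [lowerCoeff_succ, add_smul, sub_smul]
      rcases k with _ | k
      · simp [lowerCoeff_zero]
      · rw [smul_comm ha, ← mul_smul ha, add_tsub_cancel_right, ← pow_succ', add_tsub_cancel_right]
        abel

theorem c_smul_pow (hz : IsHighestWeight (m := m) (n := n) (ξ := ξ) β γ z) (hξ : ξ ≠ 0) {k : ℕ}
    (hk : k < n) : hc • ha ^ k • z = (ξ ^ k * γ) • ha ^ k • z :=
  (hz.c_d_smul_pow hξ k hk k le_rfl).1

theorem d_smul_pow (hz : IsHighestWeight (m := m) (n := n) (ξ := ξ) β γ z) (hξ : ξ ≠ 0) {k : ℕ}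
    (hk : k < n) : hd • ha ^ k • z = lowerCoeff m ξ β γ k • ha ^ (k - 1) • z :=
  (hz.c_d_smul_pow hξ k hk k le_rfl).2

theorem a_pow_smul (hz : IsHighestWeight (m := m) (n := n) (ξ := ξ) β γ z) :
    ha ^ n • z = (β ^ n - 1) • z := by
  rw [gen_a_pow, sub_smul, pow_smul_of_smul_eq hz.b_smul, one_smul, sub_smul, one_smul]

theorem exists_eq_smul_of_d_smul_eq_zero
    (hz : IsHighestWeight (m := m) (n := n) (ξ := ξ) β γ z) (hξ : ξ ≠ 0)
    (hδ : ∀ k, k + 1 < n → lowerCoeff m ξ β γ (k + 1) ≠ 0)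
    (hli : LinearIndependent 𝕜 fun k : Fin n => ha ^ (k : ℕ) • z)
    (hspan : Submodule.span 𝕜 (Set.range fun k : Fin n => ha ^ (k : ℕ) • z) = ⊤)
    {v : V} (hv : hd • v = 0) : ∃ s : 𝕜, v = s • z := by
  obtain ⟨c, rfl⟩ :=
    (Submodule.mem_span_range_iff_exists_fun 𝕜).mp (hspan ▸ Submodule.mem_top : v ∈ _)
  rcases n with _ | p
  · exact ⟨0, by simp⟩
  have hdv : ∑ k : Fin p, (c k.succ * lowerCoeff m ξ β γ (k + 1)) •
      gen 𝕜 m (p + 1) ξ 0 ^ (k : ℕ) • z = 0 := by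
    rw [← hv, Finset.smul_sum, Fin.sum_univ_succ, smul_comm, hz.d_smul_pow hξ (by simp)]
    simp only [Fin.val_zero, lowerCoeff_zero, zero_smul, smul_zero, zero_add]
    refine Finset.sum_congr rfl fun k _ => ?_
    rw [smul_comm (gen 𝕜 m (p + 1) ξ 3), hz.d_smul_pow hξ k.succ.2, smul_smul, Fin.val_succ, Nat.add_sub_cancel]
  have h0 := Fintype.linearIndependent_iff.mp
    (hli.comp Fin.castSucc (Fin.castSucc_injective p)) _ hdv
  refine ⟨c 0, ?_⟩
  rw [Fin.sum_univ_succ, Finset.sum_eq_zero fun k _ => ?_]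
  · simp
  · rw [(mul_eq_zero.mp (h0 k)).resolve_right (hδ k (by omega)), zero_smul]

theorem isSimpleModule (hz : IsHighestWeight (m := m) (n := n) (ξ := ξ) β γ z) (hξ : ξ ≠ 0)
    (hn : 0 < n) (hδ : ∀ k, k + 1 < n → lowerCoeff m ξ β γ (k + 1) ≠ 0)
    (hli : LinearIndependent 𝕜 fun k : Fin n => ha ^ (k : ℕ) • z)
    (hspan : Submodule.span 𝕜 (Set.range fun k : Fin n => ha ^ (k : ℕ) • z) = ⊤) :
    IsSimpleModule (H 𝕜 m n ξ) V := by
  have hz0 : z ≠ 0 := by simpa using hli.ne_zero ⟨0, hn⟩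
  refine isSimpleModule_iff_toSpanSingleton_surjective.mpr ⟨⟨z, 0, hz0⟩, fun v hv w => ?_⟩
  have hex : ∃ s, hd ^ s • v = 0 := ⟨n, by rw [gen_d_pow, zero_smul]⟩
  classical
  obtain ⟨t, ht⟩ : ∃ t, Nat.find hex = t + 1 :=
    Nat.exists_eq_succ_of_ne_zero fun h => hv (by simpa [h] using Nat.find_spec hex)
  obtain ⟨s, hs⟩ := hz.exists_eq_smul_of_d_smul_eq_zero hξ hδ hli hspan (v := hd ^ t • v) (by
    rw [← mul_smul, ← pow_succ', ← ht]
    exact Nat.find_spec hex)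
  have hs0 : s ≠ 0 := by
    rintro rfl
    exact Nat.find_min hex (show t < Nat.find hex by omega) (by rw [hs, zero_smul])
  obtain ⟨c, rfl⟩ :=
    (Submodule.mem_span_range_iff_exists_fun 𝕜).mp (hspan ▸ Submodule.mem_top : w ∈ _)
  refine ⟨(∑ k, c k • ha ^ (k : ℕ)) * s⁻¹ • hd ^ t, ?_⟩
  rw [LinearMap.toSpanSingleton_apply, mul_smul, smul_assoc, hs, smul_smul, inv_mul_cancel₀ hs0,
    one_smul, Finset.sum_smul]
  exact Finset.sum_congr rfl fun k _ => smul_assoc _ _ _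

variable {W : Type} [AddCommGroup W] [Module 𝕜 W] [Module (H 𝕜 m n ξ) W]
  [IsScalarTower 𝕜 (H 𝕜 m n ξ) W] {w : W}

theorem nonempty_linearEquiv (hz : IsHighestWeight (m := m) (n := n) (ξ := ξ) β γ z)
    (hw : IsHighestWeight (m := m) (n := n) (ξ := ξ) β γ w) (hξ : ξ ≠ 0)
    (hli : LinearIndependent 𝕜 fun k : Fin n => ha ^ (k : ℕ) • z)
    (hspan : Submodule.span 𝕜 (Set.range fun k : Fin n => ha ^ (k : ℕ) • z) = ⊤)
    (hli' : LinearIndependent 𝕜 fun k : Fin n => ha ^ (k : ℕ) • w)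
    (hspan' : Submodule.span 𝕜 (Set.range fun k : Fin n => ha ^ (k : ℕ) • w) = ⊤) :
    Nonempty (V ≃ₗ[H 𝕜 m n ξ] W) := by
  let bV := Module.Basis.mk hli hspan.ge
  let bW := Module.Basis.mk hli' hspan'.ge
  let e : V ≃ₗ[𝕜] W := bV.equiv bW (Equiv.refl _)
  have he {k : ℕ} (hk : k < n) : e (ha ^ k • z) = ha ^ k • w := by
    simpa [bV, bW] using bV.equiv_apply ⟨k, hk⟩ bW (Equiv.refl _)
  have hgen (g : Fin 4) (v : V) : e (gen 𝕜 m n ξ g • v) = gen 𝕜 m n ξ g • e v := by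
    have hg (x : H 𝕜 m n ξ) (h : ∀ k < n, e (x • ha ^ k • z) = x • ha ^ k • w) (v : V) :
        e (x • v) = x • e v := by
      suffices e.toLinearMap ∘ₗ Algebra.lsmul 𝕜 𝕜 V x = Algebra.lsmul 𝕜 𝕜 W x ∘ₗ e.toLinearMap from
        LinearMap.congr_fun this v
      refine bV.ext fun k => ?_
      simpa [bV, he k.2] using h k k.2
    refine hg _ (fun k hk => ?_) v
    fin_cases g
    · change e (ha • _) = ha • _
      rw [← mul_smul, ← mul_smul, ← pow_succ']
      rcases (Nat.succ_le_of_lt hk).lt_or_eq with h | h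
      · exact he h
      · have h0 : e z = w := by simpa using he (k := 0) (by omega)
        rw [← Nat.succ_eq_add_one, h, hz.a_pow_smul, hw.a_pow_smul, map_smul, h0]
    · change e (hb • _) = hb • _
      rw [hz.b_smul_pow hξ, hw.b_smul_pow hξ, map_smul, he hk]
    · change e (hc • _) = hc • _
      rw [hz.c_smul_pow hξ hk, hw.c_smul_pow hξ hk, map_smul, he hk]
    · change e (hd • _) = hd • _
      rw [hz.d_smul_pow hξ hk, hw.d_smul_pow hξ hk, map_smul, he (by omega)]
  exact ⟨{ e with map_smul' := map_smul_of_map_gen_smul e.toLinearMap hgen }⟩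

theorem weight_eq_of_linearEquiv {β' γ' : 𝕜}
    (hz : IsHighestWeight (m := m) (n := n) (ξ := ξ) β γ z)
    (hw : IsHighestWeight (m := m) (n := n) (ξ := ξ) β' γ' w) (hz0 : z ≠ 0) (hξ : ξ ≠ 0)
    (hδ : ∀ k, k + 1 < n → lowerCoeff m ξ β' γ' (k + 1) ≠ 0)
    (hli : LinearIndependent 𝕜 fun k : Fin n => ha ^ (k : ℕ) • w)
    (hspan : Submodule.span 𝕜 (Set.range fun k : Fin n => ha ^ (k : ℕ) • w) = ⊤)
    (f : V ≃ₗ[H 𝕜 m n ξ] W) : β = β' ∧ γ = γ' := by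
  obtain ⟨s, hs⟩ := hw.exists_eq_smul_of_d_smul_eq_zero hξ hδ hli hspan (v := f z) (by
    rw [← map_smul, hz.d_smul, map_zero])
  have hfz : f z ≠ 0 := by simpa using hz0
  have hf (r : 𝕜) : f (r • z) = r • f z := f.toLinearMap.map_smul_of_tower r z
  constructor
  · refine smul_left_injective 𝕜 hfz ?_
    change β • f z = β' • f z
    rw [← hf, ← hz.b_smul, map_smul, hs, smul_comm, hw.b_smul, smul_comm]
  · refine smul_left_injective 𝕜 hfz ?_
    change γ • f z = γ' • f z
    rw [← hf, ← hz.c_smul, map_smul, hs, smul_comm, hw.c_smul, smul_comm]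

end IsHighestWeight

theorem zpow_eq_zpow_iff_modEq {K : Type} [Field K] {ζ : K} {N : ℕ} (hζ : IsPrimitiveRoot ζ N)
    (hN : N ≠ 0) (i j : ℤ) : ζ ^ i = ζ ^ j ↔ Int.ModEq N i j := by
  have h0 : ζ ≠ 0 := hζ.ne_zero hN
  rw [Int.modEq_comm, Int.modEq_iff_dvd, ← hζ.zpow_eq_one_iff_dvd, zpow_sub₀ h0,
    div_eq_one_iff_eq (zpow_ne_zero _ h0)]

theorem lowerCoeff_zpow_ne_zero (hm : 1 < m) (hn : 1 < n) (hξ : IsPrimitiveRoot ξ (m * n))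
    {i j : ℤ} (hij : ∀ k : ℕ, k ≤ n - 2 → (ξ ^ m) ^ (i + k) ≠ ξ ^ j) (k : ℕ) (hk : k + 1 < n) :
    lowerCoeff m ξ (ξ ^ j) (ξ ^ i) (k + 1) ≠ 0 := by
  refine lowerCoeff_succ_ne_zero hm hn hξ hk fun h => hij k (by omega) ?_
  have h0 : ξ ≠ 0 := hξ.ne_zero (by positivity)
  rw [← h, zpow_add₀ (pow_ne_zero _ h0), zpow_natCast, mul_comm, ← zpow_natCast ξ m,
    ← zpow_natCast (ξ ^ i) m, zpow_comm]

end InducedModule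

/-- Lemma 3.1: for `(i,j), (i',j') ∈ I_0`, the induced module `Z(λ_{ij})` is
simple, and `Z(λ_{ij}) ≅ Z(λ_{i'j'})` iff `(i,j) = (i',j')` in `ℤ_{mn} × ℤ_{mn}`.  Here
`IsZrep 𝕜 m n ξ i j V` says that `V` realizes `Z(λ_{ij})`. -/
theorem statement4 (𝕜 : Type) [Field 𝕜] [IsAlgClosed 𝕜] (m n : ℕ) (hm : 1 < m) (hn : 1 < n)
    (ξ : 𝕜) (hξ : IsPrimitiveRoot ξ (m * n)) (i j i' j' : ℤ)
    (hij : ∀ k : ℕ, k ≤ n - 2 → (ξ ^ m) ^ (i + k) ≠ ξ ^ j)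
    (hij' : ∀ k : ℕ, k ≤ n - 2 → (ξ ^ m) ^ (i' + k) ≠ ξ ^ j') :
    (∀ (V : Type) [AddCommGroup V] [Module 𝕜 V] [Module (H 𝕜 m n ξ) V]
        [IsScalarTower 𝕜 (H 𝕜 m n ξ) V],
      IsZrep 𝕜 m n ξ i j V → IsSimpleModule (H 𝕜 m n ξ) V) ∧
    (∀ (V W : Type) [AddCommGroup V] [Module 𝕜 V] [Module (H 𝕜 m n ξ) V]
        [IsScalarTower 𝕜 (H 𝕜 m n ξ) V] [AddCommGroup W] [Module 𝕜 W] [Module (H 𝕜 m n ξ) W]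
        [IsScalarTower 𝕜 (H 𝕜 m n ξ) W],
      IsZrep 𝕜 m n ξ i j V → IsZrep 𝕜 m n ξ i' j' W →
      (Nonempty (V ≃ₗ[H 𝕜 m n ξ] W) ↔
        Int.ModEq ((m : ℤ) * n) i i' ∧ Int.ModEq ((m : ℤ) * n) j j')) := by
  have hξ0 : ξ ≠ 0 := hξ.ne_zero (by positivity)
  have hδ := lowerCoeff_zpow_ne_zero hm hn hξ hij
  have hδ' := lowerCoeff_zpow_ne_zero hm hn hξ hij'
  refine ⟨fun V _ _ _ _ => ?_, fun V W _ _ _ _ _ _ _ _ => ?_⟩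
  · rintro ⟨z, hdz, hbz, hcz, hli, hspan⟩
    exact IsHighestWeight.isSimpleModule ⟨hdz, hbz, hcz⟩ hξ0 (by omega) hδ hli hspan
  · rintro ⟨z, hdz, hbz, hcz, hli, hspan⟩ ⟨w, hdw, hbw, hcw, hli', hspan'⟩
    have hz : IsHighestWeight (ξ ^ j) (ξ ^ i) z := ⟨hdz, hbz, hcz⟩
    have hw : IsHighestWeight (ξ ^ j') (ξ ^ i') w := ⟨hdw, hbw, hcw⟩
    have hz0 : z ≠ 0 := by simpa using hli.ne_zero ⟨0, by omega⟩
    have hmod := zpow_eq_zpow_iff_modEq hξ (by positivity)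
    push_cast at hmod
    rw [← hmod, ← hmod]
    constructor
    · rintro ⟨f⟩
      exact (hz.weight_eq_of_linearEquiv hw hz0 hξ0 hδ' hli' hspan' f).symm
    · rintro ⟨hi, hj⟩
      rw [← hi, ← hj] at hw
      exact hz.nonempty_linearEquiv hw hξ0 hli hspan hli' hspan'

end Radford
end
end
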